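/- Let m > 3 and let f : R^m → R be a function satisfying the following three conditions: (1) for every x ∈ R^m with 1 ≤ w(x) ≤ 2, f(x) = 0; (2) for every x ∈ R^m with w(x) = m having exactly one unit component and such that for some r with 1 ≤ r ≤ n−1 every non-unit component of x is of the form p^r·(unit), one has f(x) = p^r; (3) for every x ∈ R^m with w(x) ≥ m−1 such that at least m−1 components of x are units (i.e., the reduction of x modulo p has weight at least m−1), and for every unit a of R, f(a·x) = f(x) and f(x) is a unit of R. Then C_f is a minimal linear code, i.e., every nonzero codeword of C_f is a minimal codeword. -/

import Mathlib

/-- The standard bilinear form (dot product) on `Fin m → R`. -/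
def dot {R : Type*} [CommRing R] {m : ℕ} (v w : Fin m → R) : R := ∑ i, v i * w i

/-- The dot product with a fixed vector, as a linear map. -/
def dotLin {R : Type*} [CommRing R] {m : ℕ} (v : Fin m → R) : (Fin m → R) →ₗ[R] R where
  toFun x := dot v x
  map_add' x y := by simp [dot, mul_add, Finset.sum_add_distrib]
  map_smul' c x := by simp [dot, Finset.mul_sum, smul_eq_mul, mul_left_comm]

/-- The orthogonal module `O(v) = {x : v·x = 0}`. -/
def orth {R : Type*} [CommRing R] {m : ℕ} (v : Fin m → R) : Submodule R (Fin m → R) :=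
  LinearMap.ker (dotLin v)

/-- Evaluation (generator-matrix) linear map attached to a family `Λ`. -/
def evalMap {R : Type*} [CommRing R] {m : ℕ} {ι : Type*} (Λ : ι → Fin m → R) :
    (Fin m → R) →ₗ[R] (ι → R) where
  toFun v i := dot v (Λ i)
  map_add' v w := by funext i; simp [dot, add_mul, Finset.sum_add_distrib]
  map_smul' c v := by funext i; simp [dot, Finset.mul_sum, smul_eq_mul, mul_assoc]

/-- The linear code attached to the family `Λ`. -/
def code {R : Type*} [CommRing R] {m : ℕ} {ι : Type*} (Λ : ι → Fin m → R) :
    Set (ι → R) := Set.range (evalMap Λ)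

/-- `c` is a minimal codeword of the code `C`. -/
def IsMinimalWord {R : Type*} [CommRing R] {ι : Type*} (C : Set (ι → R)) (c : ι → R) : Prop :=
  c ≠ 0 ∧ ∀ c' ∈ C, (∀ i, c' i ≠ 0 → c i ≠ 0) → ∃ a : R, c' = a • c

/-- `C` is a minimal linear code: all its nonzero codewords are minimal. -/
def IsMinimalCode {R : Type*} [CommRing R] {ι : Type*} (C : Set (ι → R)) : Prop :=
  ∀ c ∈ C, c ≠ 0 → IsMinimalWord C c

/-- Hamming weight. -/
noncomputable def wt {R : Type*} [Zero R] {m : ℕ} (x : Fin m → R) : ℕ := {i | x i ≠ 0}.ncard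

/-- The submodule `M(v,Λ)` generated by those members of `Λ` orthogonal to `v`. -/
def MvLam {R : Type*} [CommRing R] {m : ℕ} {ι : Type*} (Λ : ι → Fin m → R) (v : Fin m → R) :
    Submodule R (Fin m → R) :=
  Submodule.span R {α | ∃ i, α = Λ i ∧ dot v (Λ i) = 0}

/-- Codeword of the function-based code `C_f`. -/
def cword {R : Type*} [CommRing R] {m : ℕ} (f : (Fin m → R) → R) (a : R) (v : Fin m → R) :
    {x : Fin m → R // x ≠ 0} → R := fun x => a * f x.1 + dot v x.1

/-- The function-based code `C_f`. -/
def Cf {R : Type*} [CommRing R] {m : ℕ} (f : (Fin m → R) → R) :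
    Set ({x : Fin m → R // x ≠ 0} → R) := {c | ∃ a v, c = cword f a v}

theorem aux_val {R : Type*} [CommRing R] [IsLocalRing R] (p n : ℕ)
    (hmax : IsLocalRing.maximalIdeal R = Ideal.span {(p : R)})
    (hpn : (p : R) ^ n = 0) (z : R) : ∃ k, k ≤ n ∧ ∃ u : Rˣ, z = (p : R) ^ k * u := by
  have key : ∀ k, k ≤ n → (∃ y, z = (p : R) ^ k * y) ∨ ∃ j, j ≤ n ∧ ∃ u : Rˣ, z = (p : R) ^ j * u := by
    intro k
    induction k with
    | zero => intro _; left; exact ⟨z, by simp⟩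
    | succ k ih =>
      intro hk
      rcases ih (by omega) with ⟨y, hy⟩ | h
      · by_cases hu : IsUnit y
        · obtain ⟨u, rfl⟩ := hu
          right; exact ⟨k, by omega, u, hy⟩
        · have hy' : y ∈ IsLocalRing.maximalIdeal R := (IsLocalRing.mem_maximalIdeal y).2 hu
          rw [hmax, Ideal.mem_span_singleton] at hy'
          obtain ⟨w, rfl⟩ := hy'
          left; exact ⟨w, by rw [hy]; ring⟩
      · right; exact h
  rcases key n le_rfl with ⟨y, hy⟩ | h
  · exact ⟨n, le_rfl, 1, by rw [hy, hpn]; simp⟩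
  · exact h

theorem aux_dot_single {R : Type*} [CommRing R] {m : ℕ} (v : Fin m → R) (c z : R) (i : Fin m) :
    dot v ((fun _ => c) + Pi.single i z) = c * dot v 1 + v i * z := by
  simp [dot, mul_add, Finset.sum_add_distrib, Finset.mul_sum, Pi.single_apply, mul_comm]

theorem aux_dot_single' {R : Type*} [CommRing R] {m : ℕ} (v : Fin m → R) (z : R) (i : Fin m) :
    dot v (Pi.single i z) = v i * z := by
  simp [dot, Pi.single_apply]

theorem aux_dot_smul {R : Type*} [CommRing R] {m : ℕ} (v x : Fin m → R) (c : R) :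
    dot v (c • x) = c * dot v x := by
  simp [dot, Finset.mul_sum, mul_left_comm]

theorem aux_smul_dot {R : Type*} [CommRing R] {m : ℕ} (v x : Fin m → R) (c : R) :
    dot (c • v) x = c * dot v x := by
  simp [dot, Finset.mul_sum, mul_assoc]

theorem stmt_18
    (R : Type) [CommRing R] [IsLocalRing R] [Fintype R]
    (p n ℓ : ℕ) (hp : p.Prime) (hn : 1 ≤ n)
    (hmax : IsLocalRing.maximalIdeal R = Ideal.span {(p : R)})
    (hpn : (p : R) ^ n = 0) (hpn1 : (p : R) ^ (n - 1) ≠ 0)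
    (hres : Nat.card (IsLocalRing.ResidueField R) = p ^ ℓ)
    (m : ℕ) (hm : 3 < m) (f : (Fin m → R) → R)
    (h1 : ∀ x : Fin m → R, 1 ≤ wt x → wt x ≤ 2 → f x = 0)
    (h2 : ∀ x : Fin m → R, ∀ r : ℕ, wt x = m → 1 ≤ r → r ≤ n - 1 →
      (∃ j₀ : Fin m, IsUnit (x j₀) ∧ ∀ j, j ≠ j₀ → ∃ u : Rˣ, x j = (p : R) ^ r * (u : R)) →
      f x = (p : R) ^ r)
    (h3 : ∀ x : Fin m → R, m - 1 ≤ wt x → m - 1 ≤ {j : Fin m | IsUnit (x j)}.ncard →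
      (∀ a : Rˣ, f ((a : R) • x) = f x) ∧ IsUnit (f x)) :
    IsMinimalCode (Cf f) := by
  have hval := aux_val p n hmax hpn
  have hz : ∀ j, (p : R) ^ j = 0 → n ≤ j := by
    intro j hj
    by_contra hlt
    exact hpn1 (by rw [show n - 1 = j + (n - 1 - j) by omega, pow_add, hj, zero_mul])
  have hpnu : ¬ IsUnit (p : R) := by
    rw [← mem_nonunits_iff, ← IsLocalRing.mem_maximalIdeal, hmax]
    exact Ideal.mem_span_singleton_self _
  have hf2 : ∀ x : Fin m → R, x ≠ 0 → wt x ≤ 2 → f x = 0 := by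
    intro x hx hw
    refine h1 x ?_ hw
    rw [Nat.one_le_iff_ne_zero, wt, Ne, Set.ncard_eq_zero]
    intro h
    apply hx
    funext i
    by_contra hi
    have : i ∈ ({i | x i ≠ 0} : Set (Fin m)) := hi
    rw [h] at this
    exact this
  have hwpair : ∀ (i j : Fin m) (y z : R), wt (Pi.single i y + Pi.single j z : Fin m → R) ≤ 2 := by
    intro i j y z
    refine (Set.ncard_le_ncard (t := {i, j}) ?_).trans ((Set.ncard_insert_le i {j}).trans (by simp))
    intro k hk
    by_contra hk'
    simp only [Set.mem_insert_iff, Set.mem_singleton_iff, not_or] at hk'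
    apply hk
    simp [Pi.single_apply, hk'.1, hk'.2]
  have hwone : ∀ (i : Fin m) (y : R), wt (Pi.single i y : Fin m → R) ≤ 2 := by
    intro i y
    simpa using hwpair i i y 0
  have hi1 : ∀ i : Fin m, ∃ j, j ≠ i := by
    intro i
    haveI : Nontrivial (Fin m) := Fin.nontrivial_iff_two_le.2 (by omega)
    exact exists_ne i
  -- vectors of the second type
  have hx2 : ∀ (i : Fin m) (r : ℕ) (z : R), 1 ≤ r → r ≤ n - 1 → IsUnit z →
      f ((fun _ => (p : R) ^ r) + Pi.single i (z - (p : R) ^ r)) = (p : R) ^ r := by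
    intro i r z hr1 hr2 hzu
    have hxi : ((fun _ => (p : R) ^ r) + Pi.single i (z - (p : R) ^ r) : Fin m → R) i = z := by
      simp
    have hxj : ∀ j, j ≠ i →
        ((fun _ => (p : R) ^ r) + Pi.single i (z - (p : R) ^ r) : Fin m → R) j = (p : R) ^ r := by
      intro j hj; simp [Pi.single_apply, hj]
    apply h2 _ r _ hr1 hr2
    · refine ⟨i, by rw [hxi]; exact hzu, fun j hj => ⟨1, by rw [hxj j hj]; simp⟩⟩
    · have : {k | ((fun _ => (p : R) ^ r) + Pi.single i (z - (p : R) ^ r) : Fin m → R) k ≠ 0}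
          = Set.univ := by
        ext k
        simp only [Set.mem_univ, iff_true, Set.mem_ofPred_eq]
        by_cases hk : k = i
        · subst hk; rw [hxi]; exact hzu.ne_zero
        · rw [hxj k hk]; intro h0; have := hz r h0; omega
      rw [wt, this]; simp
  -- vectors of the third type
  have hx3 : ∀ (i : Fin m) (z : R),
      (∀ a : Rˣ, f ((a : R) • ((fun _ => 1) + Pi.single i z)) = f ((fun _ => 1) + Pi.single i z)) ∧
        IsUnit (f ((fun _ => 1) + Pi.single i z)) := by
    intro i z
    have hxj : ∀ j, j ≠ i → ((fun _ => 1) + Pi.single i z : Fin m → R) j = 1 := by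
      intro j hj; simp [Pi.single_apply, hj]
    have hc : ({i}ᶜ : Set (Fin m)).ncard = m - 1 := by
      rw [Set.ncard_compl]; simp
    apply h3
    · rw [← hc]
      refine Set.ncard_le_ncard ?_ (Set.toFinite _)
      intro j hj
      simp only [Set.mem_ofPred_eq]
      rw [hxj j hj]; exact one_ne_zero
    · rw [← hc]
      refine Set.ncard_le_ncard ?_ (Set.toFinite _)
      intro j hj
      simp only [Set.mem_ofPred_eq]
      rw [hxj j hj]; exact isUnit_one
  rintro c ⟨a, v, rfl⟩ hc0
  refine ⟨hc0, ?_⟩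
  rintro c' ⟨b, w, rfl⟩ hsupp
  have hs : ∀ x : Fin m → R, x ≠ 0 → a * f x + dot v x = 0 → b * f x + dot w x = 0 := by
    intro x hx h
    by_contra h'
    exact hsupp ⟨x, hx⟩ h' h
  have hs2 : ∀ x : Fin m → R, x ≠ 0 → wt x ≤ 2 → dot v x = 0 → dot w x = 0 := by
    intro x hx hw h
    have := hs x hx (by rw [hf2 x hx hw, h]; simp)
    rwa [hf2 x hx hw, mul_zero, zero_add] at this
  suffices H : ∃ t : R, b = t * a ∧ w = t • v by
    obtain ⟨t, rfl, rfl⟩ := H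
    refine ⟨t, ?_⟩
    funext x
    simp only [cword, Pi.smul_apply, smul_eq_mul, aux_smul_dot]
    ring
  have hsingle : ∀ (i : Fin m) (z : R), z ≠ 0 → (Pi.single i z : Fin m → R) ≠ 0 := by
    intro i z hz h; exact hz (by simpa using h)
  by_cases hv : v = 0
  · subst hv
    have hw : w = 0 := by
      funext i
      have := hs2 (Pi.single i 1) (hsingle i 1 one_ne_zero) (hwone i 1) (by simp [dot])
      rw [aux_dot_single'] at this
      simpa using this
    subst hw
    obtain ⟨r, hr, u, rfl⟩ := hval a
    obtain ⟨s, hs', u', rfl⟩ := hval b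
    by_cases hrs : r ≤ s
    · refine ⟨(p : R) ^ (s - r) * u' * (u⁻¹ : Rˣ), ?_, by simp⟩
      have : (p : R) ^ s = (p : R) ^ (s - r) * (p : R) ^ r := by
        rw [← pow_add]; congr 1; omega
      rw [this]
      linear_combination (-(p : R) ^ (s - r) * (p : R) ^ r * u') * u.inv_mul
    · exfalso
      by_cases hrn : r = n
      · apply hc0
        funext x
        simp [cword, dot, hrn, hpn]
      have i : Fin m := ⟨0, by omega⟩
      have hfx := hx2 i (n - r) 1 (by omega) (by omega) isUnit_one
      have := hs ((fun _ => (p : R) ^ (n - r)) + Pi.single i (1 - (p : R) ^ (n - r)))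
        (fun h => ?_) ?_
      rotate_left
      · have := congrFun h i
        simp at this
      · rw [hfx]
        have e : (p : R) ^ r * (p : R) ^ (n - r) = 0 := by
          rw [← pow_add, show r + (n - r) = n by omega, hpn]
        simp only [dot, Pi.zero_apply, zero_mul, Finset.sum_const_zero]
        linear_combination (u : R) * e
      · rw [hfx] at this
        simp only [dot, Pi.zero_apply, zero_mul, Finset.sum_const_zero, add_zero] at this
        rw [mul_right_comm, ← pow_add, Units.mul_left_eq_zero] at this
        have := hz _ this
        omega
  · -- main case
    choose k hk u hu using fun i => hval (v i)
    obtain ⟨i, -, hi⟩ := Finset.exists_min_image Finset.univ k ⟨⟨0, by omega⟩, Finset.mem_univ _⟩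
    have hdiv : ∀ j, ∃ y, v j = v i * y := by
      intro j
      refine ⟨(p : R) ^ (k j - k i) * u j * ((u i)⁻¹ : Rˣ), ?_⟩
      have hij := hi j (Finset.mem_univ _)
      have : (p : R) ^ k j = (p : R) ^ (k j - k i) * (p : R) ^ k i := by
        rw [← pow_add]; congr 1; omega
      conv_lhs => rw [hu j, this]
      conv_rhs => rw [hu i]
      linear_combination (-(p : R) ^ (k j - k i) * (p : R) ^ k i * u j) * (u i).mul_inv
    obtain ⟨s, hsn, ug, hg⟩ : ∃ s, s < n ∧ ∃ ug : Rˣ, v i = (p : R) ^ s * ug := by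
      refine ⟨k i, lt_of_le_of_ne (hk i) ?_, u i, hu i⟩
      intro hkn
      apply hv
      funext j
      obtain ⟨y, hy⟩ := hdiv j
      rw [hy, hu i, hkn, hpn]; simp
    obtain ⟨v', hv'i, hvv⟩ : ∃ v' : Fin m → R, v' i = ug ∧ v = (p : R) ^ s • v' := by
      choose y hy using hdiv
      refine ⟨fun j => if j = i then (ug : R) else ug * y j, by simp, ?_⟩
      funext j
      by_cases hj : j = i
      · subst hj; simp [hg]
      · simp only [Pi.smul_apply, smul_eq_mul, if_neg hj]
        rw [hy j, hg]; ring
    clear hdiv hi hu u hk k hg hv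
    subst hvv
    -- w is a multiple of v
    have hw1 : ∀ j, w j * ug = w i * v' j := by
      intro j
      by_cases hj : j = i
      · subst hj; rw [hv'i]
      have := hs2 (Pi.single j (ug : R) + Pi.single i (-v' j)) ?_ (hwpair _ _ _ _) ?_
      · have e : dot w (Pi.single j (ug : R) + Pi.single i (-v' j)) = w j * ug + w i * (-v' j) := by
          rw [← aux_dot_single', ← aux_dot_single']
          simp [dot, mul_add, Finset.sum_add_distrib]
        rw [e] at this
        linear_combination this
      · intro h
        have := congrFun h j
        simp [Pi.single_apply, hj] at this
      · have e : dot v' (Pi.single j (ug : R) + Pi.single i (-v' j)) = v' j * ug + v' i * (-v' j) := by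
          rw [← aux_dot_single', ← aux_dot_single']
          simp [dot, mul_add, Finset.sum_add_distrib]
        rw [aux_smul_dot, e, hv'i]
        ring
    have hw2 : ∃ t0, w i = (p : R) ^ s * t0 := by
      obtain ⟨l, hl, u, hu⟩ := hval (w i)
      by_cases hsl : s ≤ l
      · refine ⟨(p : R) ^ (l - s) * u, ?_⟩
        rw [hu, ← mul_assoc, ← pow_add, show s + (l - s) = l by omega]
      exfalso
      have := hs2 (Pi.single i ((p : R) ^ (n - s))) (hsingle _ _ ?_) (hwone _ _) ?_
      · rw [aux_dot_single', hu, mul_right_comm, ← pow_add, Units.mul_left_eq_zero] at this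
        have := hz _ this
        omega
      · intro h; have := hz _ h; omega
      · rw [aux_smul_dot, aux_dot_single', mul_left_comm, ← pow_add, show s + (n - s) = n by omega,
          hpn, mul_zero]
    obtain ⟨t, rfl⟩ : ∃ t : R, w = t • ((p : R) ^ s • v') := by
      obtain ⟨t0, ht0⟩ := hw2
      refine ⟨t0 * (ug⁻¹ : Rˣ), ?_⟩
      funext j
      have h := hw1 j
      rw [ht0] at h
      simp only [Pi.smul_apply, smul_eq_mul]
      linear_combination ((ug⁻¹ : Rˣ) : R) * h - w j * ug.mul_inv
    have hd : ∀ x : Fin m → R, x ≠ 0 → a * f x + (p : R) ^ s * dot v' x = 0 →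
        (b - t * a) * f x = 0 := by
      intro x hx h
      have h' := hs x hx (by rw [aux_smul_dot]; exact h)
      rw [aux_smul_dot, aux_smul_dot] at h'
      linear_combination h' - t * h
    suffices H : ∃ t', b - t * a = t' * a ∧ t' * (p : R) ^ s = 0 by
      obtain ⟨t', ht1, ht2⟩ := H
      refine ⟨t + t', by linear_combination ht1, ?_⟩
      funext j
      simp only [Pi.smul_apply, smul_eq_mul]
      linear_combination (-v' j) * ht2
    obtain ⟨r, hr, u, rfl⟩ := hval a
    by_cases hsr : s ≤ r
    · -- third type
      refine ⟨0, ?_, by simp⟩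
      rw [zero_mul]
      set a' : R := (p : R) ^ (r - s) * u with ha'
      have hpa : (p : R) ^ r * u = (p : R) ^ s * a' := by
        rw [ha', ← mul_assoc, ← pow_add, show s + (r - s) = r by omega]
      set z : R := (ug⁻¹ : Rˣ) * (a' - dot v' 1) with hzdef
      obtain ⟨hinv, hun⟩ := hx3 i z
      obtain ⟨fu, hfu⟩ := hun
      have hdot : dot v' ((fun _ => 1) + Pi.single i z) = a' := by
        rw [aux_dot_single, hv'i, hzdef]
        linear_combination (a' - dot v' 1) * ug.mul_inv
      have := hd (((-fu : Rˣ) : R) • ((fun _ => 1) + Pi.single i z)) ?_ ?_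
      · rw [hinv, ← hfu, Units.mul_left_eq_zero] at this
        exact this
      · intro h
        obtain ⟨j, hj⟩ := hi1 i
        have := congrFun h j
        simp [Pi.single_apply, hj] at this
      · rw [hinv, ← hfu, aux_dot_smul, hdot, hpa]
        push_cast
        ring
    · -- second type
      set e := s - r with he
      set T : R := dot v' 1 with hT
      set y : R := (ug⁻¹ : Rˣ) * (-u - (p : R) ^ e * T) + (p : R) ^ e with hy
      have hyu : IsUnit y := by
        by_contra hny
        have hpe : (p : R) ∣ (p : R) ^ e := dvd_pow_self _ (by omega)
        have hyd : (p : R) ∣ y := by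
          rw [← Ideal.mem_span_singleton, ← hmax, IsLocalRing.mem_maximalIdeal]; exact hny
        have : (p : R) ∣ -u := by
          have e2 : -(u : R) = ug * y + (p : R) ^ e * (T - ug) := by
            rw [hy]
            linear_combination ((u : R) + (p : R) ^ e * T) * ug.mul_inv
          rw [e2]
          exact dvd_add (hyd.mul_left _) (hpe.mul_right _)
        exact hpnu (isUnit_of_dvd_unit this u.isUnit.neg)
      have hfx := hx2 i e y (by omega) (by omega) hyu
      have hdot : dot v' ((fun _ => (p : R) ^ e) + Pi.single i (y - (p : R) ^ e)) = -u := by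
        rw [aux_dot_single, hv'i, hy]
        linear_combination (-(u : R) - (p : R) ^ e * T) * ug.mul_inv
      have := hd ((fun _ => (p : R) ^ e) + Pi.single i (y - (p : R) ^ e)) ?_ ?_
      · rw [hfx] at this
        obtain ⟨l, hl, ud, hud⟩ := hval (b - t * (p ^ r * u))
        rw [hud, mul_right_comm, ← pow_add, Units.mul_left_eq_zero] at this
        have hle := hz _ this
        refine ⟨(p : R) ^ (l - r) * ud * (u⁻¹ : Rˣ), ?_, ?_⟩
        · have e3 : (p : R) ^ l = (p : R) ^ (l - r) * (p : R) ^ r := by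
            rw [← pow_add]; congr 1; omega
          rw [hud, e3]
          linear_combination (-(p : R) ^ (l - r) * (p : R) ^ r * ud) * u.inv_mul
        · have e3 : (p : R) ^ (l - r) * (p : R) ^ s = 0 := by
            rw [← pow_add, show l - r + s = n + (l - r + s - n) by omega, pow_add, hpn, zero_mul]
          linear_combination (ud : R) * ((u⁻¹ : Rˣ) : R) * e3
      · intro h
        have := congrFun h i
        simp at this
        rw [this] at hyu
        exact not_isUnit_zero hyu
      · rw [hfx, hdot]
        have e3 : (p : R) ^ s = (p : R) ^ r * (p : R) ^ e := by
          rw [← pow_add]; congr 1; omega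
        rw [e3]; ring
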